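/- arXiv:2307.12340 — 2 statements merged into one kernel-verified Lean document; each statement's English description precedes it below -/
import Mathlib

section
/- Assume g ∈ C²([0,∞)) satisfies (A1) g(t)>0 and g'(t)>0, (A2) 1/g ∈ L¹(0,∞), and (A3) |d_t^k g(t)| ≤ C_k g(t)(g(t)/G(t))^k for k=1,2, with G(t)=½∫₀ᵗ g(τ)dτ. Consider the 2×2 complex matrix A_V(t,ξ) with entries A₁₁ = −i g'(t)/g(t), A₁₂ = g(t)|ξ|²/2, A₂₁ = −g(t)|ξ|²/2 − (g'(t)−2)/g(t), A₂₂ = 0, and let E_V(·,s,ξ) be the fundamental solution, i.e. ∂_t E_V(t,s,ξ) = i A_V(t,ξ) E_V(t,s,ξ), E_V(s,s,ξ) = I. Then there exist N > 0 and C > 0 such that for all ξ ≠ 0 and all s ≤ t with G(s)|ξ|² ≥ N, every entry satisfies |E_V^{(kℓ)}(t,s,ξ)| ≤ C (g(t)/g(s)) exp( (|ξ|²/2) ∫_s^t g(τ)dτ ). -/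
open Set MeasureTheory

lemma aux_scalar {w q e : ℝ} (hw : 0 ≤ w) (he : 0 < e) (hq : 0 < q) (h : q ^ 2 = w ^ 2 + e ^ 2) :
    (w - e) * q ≤ w ^ 2 := by
  have h1 : q ≤ w + e := by nlinarith [mul_nonneg hw he.le]
  rcases le_total e w with h2 | h2
  · nlinarith [mul_le_mul_of_nonneg_left h1 (sub_nonneg.2 h2)]
  · nlinarith [mul_nonneg (sub_nonneg.2 h2) hq.le]

lemma aux_eps (V W : ℝ → ℂ) (g g' A : ℝ → ℝ) (m s t e : ℝ) (hm : 0 < m) (hst : s ≤ t) (he : 0 < e)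
    (hVc : ContinuousOn V (Icc s t)) (hWc : ContinuousOn W (Icc s t))
    (hgc : ContinuousOn g (Icc s t)) (hAc : ContinuousOn A (Icc s t))
    (hg0 : ∀ τ ∈ Icc s t, 0 < g τ) (hg1 : ∀ τ ∈ Ioo s t, 0 ≤ g' τ)
    (hA0 : ∀ τ ∈ Icc s t, 0 ≤ A τ)
    (hg : ∀ τ ∈ Ioo s t, HasDerivAt g (g' τ) τ)
    (hA : ∀ τ ∈ Ioo s t, HasDerivAt A (1 / g τ) τ)
    (hV : ∀ τ ∈ Ioo s t, HasDerivAt V ((m : ℂ) * W τ) τ)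
    (hW : ∀ τ ∈ Ioo s t, HasDerivAt W (-((2 * m * g τ : ℝ) : ℂ) * W τ - 2 * V τ) τ) :
    Real.exp (-A t) * (Real.sqrt (‖V t‖ ^ 2 + e ^ 2) + Real.sqrt (‖W t‖ ^ 2 + e ^ 2) / (2 * g t))
      - m * e * (t - s) ≤
    Real.exp (-A s) * (Real.sqrt (‖V s‖ ^ 2 + e ^ 2) + Real.sqrt (‖W s‖ ^ 2 + e ^ 2) / (2 * g s))
      - m * e * (s - s) := by
  set F : ℝ → ℝ := fun τ => Real.exp (-A τ) *
    (Real.sqrt (‖V τ‖ ^ 2 + e ^ 2) + Real.sqrt (‖W τ‖ ^ 2 + e ^ 2) / (2 * g τ))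
      - m * e * (τ - s) with hF
  have key : ∀ τ ∈ Ioo s t, ∃ d, HasDerivAt F d τ ∧ d ≤ 0 := by
    intro τ hτ
    have hτ' := Ioo_subset_Icc_self hτ
    have gp := hg0 τ hτ'
    have hp := (((hV τ hτ).norm_sq).add_const (e ^ 2)).sqrt (by positivity)
    have hq := (((hW τ hτ).norm_sq).add_const (e ^ 2)).sqrt (by positivity)
    have hq2 := hq.div ((hg τ hτ).const_mul 2) (by positivity)
    have hE := (hA τ hτ).neg.exp
    have hfin := (hE.mul (hp.add hq2)).sub
      (((hasDerivAt_id τ).sub_const s).const_mul (m * e))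
    refine ⟨_, hfin, ?_⟩
    simp only [Pi.add_apply, Pi.div_apply, Pi.neg_apply]
    have hpp : 0 < Real.sqrt (‖V τ‖ ^ 2 + e ^ 2) := by positivity
    have hqq : 0 < Real.sqrt (‖W τ‖ ^ 2 + e ^ 2) := by positivity
    have hps : Real.sqrt (‖V τ‖ ^ 2 + e ^ 2) ^ 2 = ‖V τ‖ ^ 2 + e ^ 2 := Real.sq_sqrt (by positivity)
    have hqs : Real.sqrt (‖W τ‖ ^ 2 + e ^ 2) ^ 2 = ‖W τ‖ ^ 2 + e ^ 2 := Real.sq_sqrt (by positivity)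
    set p := Real.sqrt (‖V τ‖ ^ 2 + e ^ 2)
    set q := Real.sqrt (‖W τ‖ ^ 2 + e ^ 2)
    have hv0 := norm_nonneg (V τ)
    have hw0 := norm_nonneg (W τ)
    have hvp : ‖V τ‖ ≤ p := by nlinarith
    have hwq : ‖W τ‖ ≤ q := by nlinarith
    have hi1 : inner ℝ (V τ) ((m : ℂ) * W τ) ≤ m * (‖V τ‖ * ‖W τ‖) := by
      refine (real_inner_le_norm _ _).trans ?_
      rw [norm_mul, Complex.norm_real, Real.norm_of_nonneg hm.le]
      exact le_of_eq (by ring)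
    have hi2 : inner ℝ (W τ) (-((2 * m * g τ : ℝ) : ℂ) * W τ - 2 * V τ)
        ≤ -(2 * m * g τ) * ‖W τ‖ ^ 2 + 2 * (‖V τ‖ * ‖W τ‖) := by
      have e1 : (-((2 * m * g τ : ℝ) : ℂ) * W τ - 2 * V τ)
          = (-(2 * m * g τ)) • W τ - (2 : ℝ) • V τ := by
        simp [Complex.real_smul]
      rw [e1, inner_sub_right, real_inner_smul_right, real_inner_smul_right,
        real_inner_self_eq_norm_sq]
      have := neg_le_of_abs_le (abs_real_inner_le_norm (W τ) (V τ))
      nlinarith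
    have b1 : 2 * inner ℝ (V τ) ((m : ℂ) * W τ) / (2 * p) ≤ m * ‖W τ‖ := by
      rw [div_le_iff₀ (by positivity)]
      nlinarith [mul_le_mul_of_nonneg_right hvp (mul_nonneg hm.le hw0)]
    have b2 : 2 * inner ℝ (W τ) (-((2 * m * g τ : ℝ) : ℂ) * W τ - 2 * V τ) / (2 * q)
        ≤ -(2 * m * g τ) * (‖W τ‖ - e) + 2 * ‖V τ‖ := by
      rw [div_le_iff₀ (by positivity)]
      have h3 := aux_scalar hw0 he hqq hqs
      have h4 := mul_le_mul_of_nonneg_left h3 (by positivity : 0 ≤ 2 * m * g τ)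
      have h5 := mul_le_mul_of_nonneg_right hwq hv0
      nlinarith
    set d1 := 2 * inner ℝ (V τ) ((m : ℂ) * W τ) / (2 * p)
    set d2 := 2 * inner ℝ (W τ) (-((2 * m * g τ : ℝ) : ℂ) * W τ - 2 * V τ) / (2 * q)
    have b3 : (d2 * (2 * g τ) - q * (2 * g' τ)) / (2 * g τ) ^ 2
        ≤ -m * ‖W τ‖ + m * e + p / g τ := by
      have : (-m * ‖W τ‖ + m * e + p / g τ)
        = ((-(2 * m * g τ) * (‖W τ‖ - e) + 2 * p) * (2 * g τ)) / (2 * g τ) ^ 2 := by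
        field_simp
        ring
      rw [this]
      gcongr
      have h6 := mul_nonneg hqq.le (hg1 τ hτ)
      have h7 : d2 * (2 * g τ) ≤ (-(2 * m * g τ) * (‖W τ‖ - e) + 2 * p) * (2 * g τ) := by
        gcongr
        linarith
      linarith
    set d3 := (d2 * (2 * g τ) - q * (2 * g' τ)) / (2 * g τ) ^ 2
    have hex : Real.exp (-A τ) ≤ 1 := Real.exp_le_one_iff.2 (by linarith [hA0 τ hτ'])
    have hex0 := Real.exp_pos (-A τ)
    have h8 : 0 ≤ (1 / g τ) * (q / (2 * g τ)) := by positivity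
    have h9 : d1 + d3 - (1 / g τ) * (p + q / (2 * g τ)) ≤ m * e := by
      have : (1 / g τ) * (p + q / (2 * g τ)) = p / g τ + (1 / g τ) * (q / (2 * g τ)) := by ring
      rw [this]; linarith
    have h10 := mul_le_mul_of_nonneg_left h9 hex0.le
    have h11 := mul_le_mul_of_nonneg_right hex (mul_pos hm he).le
    nlinarith
  have hanti : AntitoneOn F (Icc s t) := by
    refine antitoneOn_of_deriv_nonpos (convex_Icc s t) ?_ ?_ ?_
    · have : ∀ τ ∈ Icc s t, 2 * g τ ≠ 0 := fun τ hτ => by have := hg0 τ hτ; positivity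
      rw [hF]
      have h1 : ContinuousOn (fun τ => Real.sqrt (‖W τ‖ ^ 2 + e ^ 2) / (2 * g τ)) (Icc s t) :=
        ContinuousOn.div (by fun_prop) (by fun_prop) this
      fun_prop
    · rw [interior_Icc]
      intro τ hτ
      obtain ⟨d, hd, -⟩ := key τ hτ
      exact hd.differentiableAt.differentiableWithinAt
    · rw [interior_Icc]
      intro τ hτ
      obtain ⟨d, hd, h⟩ := key τ hτ
      rw [hd.deriv]; exact h
  exact hanti (left_mem_Icc.2 hst) (right_mem_Icc.2 hst) hst

lemma aux_core (V W : ℝ → ℂ) (g g' A : ℝ → ℝ) (m s t : ℝ) (hm : 0 < m) (hst : s ≤ t)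
    (hVc : ContinuousOn V (Icc s t)) (hWc : ContinuousOn W (Icc s t))
    (hgc : ContinuousOn g (Icc s t)) (hAc : ContinuousOn A (Icc s t))
    (hg0 : ∀ τ ∈ Icc s t, 0 < g τ) (hg1 : ∀ τ ∈ Ioo s t, 0 ≤ g' τ)
    (hA0 : ∀ τ ∈ Icc s t, 0 ≤ A τ) (hAs : A s = 0)
    (hg : ∀ τ ∈ Ioo s t, HasDerivAt g (g' τ) τ)
    (hA : ∀ τ ∈ Ioo s t, HasDerivAt A (1 / g τ) τ)
    (hV : ∀ τ ∈ Ioo s t, HasDerivAt V ((m : ℂ) * W τ) τ)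
    (hW : ∀ τ ∈ Ioo s t, HasDerivAt W (-((2 * m * g τ : ℝ) : ℂ) * W τ - 2 * V τ) τ) :
    Real.exp (-A t) * (‖V t‖ + ‖W t‖ / (2 * g t)) ≤ ‖V s‖ + ‖W s‖ / (2 * g s) := by
  have gs := hg0 s (left_mem_Icc.2 hst)
  have gt := hg0 t (right_mem_Icc.2 hst)
  refine le_of_forall_pos_le_add fun δ hδ => ?_
  set D := 1 + 1 / (2 * g s) + m * (t - s) with hD
  have hD0 : 0 < D := by
    have := sub_nonneg.2 hst
    positivity
  have he : 0 < δ / D := by positivity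
  have h := aux_eps V W g g' A m s t (δ / D) hm hst he hVc hWc hgc hAc hg0 hg1 hA0 hg hA hV hW
  have hδ' : δ = δ / D * D := by field_simp
  set e := δ / D
  have up : ∀ z : ℂ, Real.sqrt (‖z‖ ^ 2 + e ^ 2) ≤ ‖z‖ + e := fun z => by
    rw [Real.sqrt_le_iff]
    have := mul_nonneg (norm_nonneg z) he.le
    exact ⟨by positivity, by nlinarith⟩
  have lo : ∀ z : ℂ, ‖z‖ ≤ Real.sqrt (‖z‖ ^ 2 + e ^ 2) := fun z =>
    Real.le_sqrt_of_sq_le (by nlinarith)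
  have h1 : Real.exp (-A t) * (‖V t‖ + ‖W t‖ / (2 * g t)) ≤ Real.exp (-A t) *
      (Real.sqrt (‖V t‖ ^ 2 + e ^ 2) + Real.sqrt (‖W t‖ ^ 2 + e ^ 2) / (2 * g t)) := by
    gcongr <;> exact lo _
  have h2 : Real.sqrt (‖V s‖ ^ 2 + e ^ 2) + Real.sqrt (‖W s‖ ^ 2 + e ^ 2) / (2 * g s)
      ≤ (‖V s‖ + e) + (‖W s‖ + e) / (2 * g s) := by
    gcongr <;> exact up _
  rw [hAs, neg_zero, Real.exp_zero, one_mul, sub_self, mul_zero, sub_zero] at h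
  have h3 : (‖V s‖ + e) + (‖W s‖ + e) / (2 * g s) + m * e * (t - s)
     = ‖V s‖ + ‖W s‖ / (2 * g s) + e * D := by rw [hD]; ring
  rw [hδ']
  linarith

/-- Estimate for one column `(x, y)` of the fundamental solution. -/
lemma aux_column (g g' A Γ : ℝ → ℝ) (m s t K : ℝ) (hm : 0 < m) (hst : s ≤ t)
    (hgc : ContinuousOn g (Icc s t)) (hAc : ContinuousOn A (Icc s t))
    (hΓc : ContinuousOn Γ (Icc s t))
    (hg0 : ∀ τ ∈ Icc s t, 0 < g τ) (hg1 : ∀ τ ∈ Ioo s t, 0 ≤ g' τ)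
    (hA0 : ∀ τ ∈ Icc s t, 0 ≤ A τ) (hAs : A s = 0) (hAK : A t ≤ K) (hΓs : Γ s = 0)
    (hg : ∀ τ ∈ Ioo s t, HasDerivAt g (g' τ) τ)
    (hA : ∀ τ ∈ Ioo s t, HasDerivAt A (1 / g τ) τ)
    (hΓ : ∀ τ ∈ Ioo s t, HasDerivAt Γ (m * g τ) τ)
    (x y : ℝ → ℂ)
    (hx : ∀ τ ∈ Icc s t, HasDerivAt x
      (Complex.I * ((-Complex.I * ((g' τ / g τ : ℝ) : ℂ)) * x τ + ((m * g τ : ℝ) : ℂ) * y τ)) τ)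
    (hy : ∀ τ ∈ Icc s t, HasDerivAt y
      (Complex.I * (((-(m * g τ) - (g' τ - 2) / g τ : ℝ) : ℂ) * x τ)) τ)
    (hx0 : ‖x s‖ ≤ 1) (hxy : ‖Complex.I * y s - x s‖ ≤ 1) :
    ‖x t‖ ≤ 6 * Real.exp K * (g t / g s) * Real.exp (Γ t) ∧
    ‖y t‖ ≤ 6 * Real.exp K * (g t / g s) * Real.exp (Γ t) := by
  have gs := hg0 s (left_mem_Icc.2 hst)
  have gt := hg0 t (right_mem_Icc.2 hst)
  have hxc : ContinuousOn x (Icc s t) := fun τ hτ => (hx τ hτ).continuousAt.continuousWithinAt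
  have hyc : ContinuousOn y (Icc s t) := fun τ hτ => (hy τ hτ).continuousAt.continuousWithinAt
  have key := aux_core (fun τ => (((g τ)⁻¹ * Real.exp (-Γ τ) : ℝ) : ℂ) * x τ)
    (fun τ => ((Real.exp (-Γ τ) : ℝ) : ℂ) * (Complex.I * y τ - x τ)) g g' A m s t hm hst
    ?_ ?_ hgc hAc hg0 hg1 hA0 hAs hg hA ?_ ?_
  · simp only [norm_mul, Complex.norm_real, hΓs, neg_zero, Real.exp_zero, norm_inv, mul_one,
      Real.norm_of_nonneg (Real.exp_pos _).le, Real.norm_of_nonneg gs.le,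
      Real.norm_of_nonneg gt.le, norm_one, one_mul] at key
    have hr : (g s)⁻¹ * ‖x s‖ + ‖Complex.I * y s - x s‖ / (2 * g s) ≤ 3 / 2 * (g s)⁻¹ := by
      calc _ ≤ (g s)⁻¹ * 1 + 1 / (2 * g s) := by gcongr
        _ = _ := by field_simp; norm_num
    have hK : Real.exp (-K) ≤ Real.exp (-A t) := Real.exp_le_exp.2 (by linarith)
    set a := ‖x t‖ with ha
    set b := ‖Complex.I * y t - x t‖ with hb
    have ha0 : 0 ≤ a := norm_nonneg _
    have hb0 : 0 ≤ b := norm_nonneg _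
    have h1 : Real.exp (-K) * ((g t)⁻¹ * Real.exp (-Γ t) * a + Real.exp (-Γ t) * b / (2 * g t))
        ≤ 3 / 2 * (g s)⁻¹ := by
      refine le_trans ?_ (key.trans hr)
      gcongr
    have h2 : a + b / 2 ≤ 3 / 2 * Real.exp K * (g t / g s) * Real.exp (Γ t) := by
      have h3 := mul_le_mul_of_nonneg_left h1
        (by positivity : 0 ≤ Real.exp K * Real.exp (Γ t) * g t)
      have h4 : Real.exp K * Real.exp (Γ t) * g t * (Real.exp (-K) *
          ((g t)⁻¹ * Real.exp (-Γ t) * a + Real.exp (-Γ t) * b / (2 * g t))) = a + b / 2 := by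
        rw [Real.exp_neg, Real.exp_neg]
        field_simp
      rw [h4] at h3
      refine h3.trans (le_of_eq ?_)
      field_simp
    have hyt : ‖y t‖ ≤ a + b := by
      have : ‖y t‖ = ‖x t + (Complex.I * y t - x t)‖ := by
        rw [add_sub_cancel, norm_mul, Complex.norm_I, one_mul]
      rw [this]; exact norm_add_le _ _
    have hpos : 0 ≤ Real.exp K * (g t / g s) * Real.exp (Γ t) := by positivity
    constructor <;> nlinarith
  · have : ContinuousOn (fun τ => (g τ)⁻¹) (Icc s t) := hgc.inv₀ fun τ hτ => (hg0 τ hτ).ne'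
    have h2 : ContinuousOn (fun τ => (g τ)⁻¹ * Real.exp (-Γ τ)) (Icc s t) := by fun_prop
    exact (Complex.continuous_ofReal.comp_continuousOn h2).mul hxc
  · have h2 : ContinuousOn (fun τ => Real.exp (-Γ τ)) (Icc s t) := by fun_prop
    exact (Complex.continuous_ofReal.comp_continuousOn h2).mul (by fun_prop)
  · intro τ hτ
    have hτ' := Ioo_subset_Icc_self hτ
    have gp := hg0 τ hτ'
    have gpc : (g τ : ℂ) ≠ 0 := by exact_mod_cast gp.ne'
    have h1 := (((hg τ hτ).inv gp.ne').mul (hΓ τ hτ).neg.exp).ofReal_comp.mul (hx τ hτ')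
    refine h1.congr_deriv ?_
    simp only [Pi.neg_apply, Pi.mul_apply, Pi.inv_apply]
    push_cast
    field_simp
    linear_combination (-(x τ) * g' τ) * Complex.I_sq
  · intro τ hτ
    have hτ' := Ioo_subset_Icc_self hτ
    have gp := hg0 τ hτ'
    have gpc : (g τ : ℂ) ≠ 0 := by exact_mod_cast gp.ne'
    have h1 := ((hΓ τ hτ).neg.exp).ofReal_comp.mul
      (((hy τ hτ').const_mul Complex.I).sub (hx τ hτ'))
    refine h1.congr_deriv ?_
    simp only [Pi.neg_apply, Pi.mul_apply, Pi.sub_apply]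
    push_cast
    field_simp
    ring_nf
    simp only [Complex.I_sq]
    ring

theorem stmt_2
    (n : ℕ)
    (g g' g'' : ℝ → ℝ)
    (hg_deriv : ∀ t ∈ Ici (0:ℝ), HasDerivWithinAt g (g' t) (Ici 0) t)
    (hg_deriv' : ∀ t ∈ Ici (0:ℝ), HasDerivWithinAt g' (g'' t) (Ici 0) t)
    (hg_cont : ContinuousOn g'' (Ici 0))
    (hA1 : ∀ t ∈ Ici (0:ℝ), 0 < g t ∧ 0 < g' t)
    (hA2 : IntegrableOn (fun t => 1 / g t) (Ici 0))
    (hA3 : ∃ C₁ > (0:ℝ), ∃ C₂ > (0:ℝ), ∀ t ∈ Ici (0:ℝ),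
      |g' t| * ((1/2) * ∫ τ in (0:ℝ)..t, g τ) ≤ C₁ * g t * g t ∧
      |g'' t| * ((1/2) * ∫ τ in (0:ℝ)..t, g τ) ^ 2 ≤ C₂ * g t * g t ^ 2)
    :
    ∃ N > (0:ℝ), ∃ C > (0:ℝ),
      ∀ (ξ : EuclideanSpace ℝ (Fin n)), ξ ≠ 0 →
      ∀ s t : ℝ, 0 ≤ s → s ≤ t →
        N ≤ ((1/2) * ∫ τ in (0:ℝ)..s, g τ) * ‖ξ‖ ^ 2 →
      ∀ E11 E12 E21 E22 : ℝ → ℂ,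
        E11 s = 1 → E12 s = 0 → E21 s = 0 → E22 s = 1 →
        (∀ τ ∈ Ici s,
          HasDerivAt E11 (Complex.I * ((-Complex.I * ((g' τ / g τ : ℝ) : ℂ)) * E11 τ + ((g τ * ‖ξ‖ ^ 2 / 2 : ℝ) : ℂ) * E21 τ)) τ ∧
          HasDerivAt E21 (Complex.I * (((-(g τ * ‖ξ‖ ^ 2 / 2) - (g' τ - 2) / g τ : ℝ) : ℂ) * E11 τ + (0 : ℂ) * E21 τ)) τ ∧
          HasDerivAt E12 (Complex.I * ((-Complex.I * ((g' τ / g τ : ℝ) : ℂ)) * E12 τ + ((g τ * ‖ξ‖ ^ 2 / 2 : ℝ) : ℂ) * E22 τ)) τ ∧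
          HasDerivAt E22 (Complex.I * (((-(g τ * ‖ξ‖ ^ 2 / 2) - (g' τ - 2) / g τ : ℝ) : ℂ) * E12 τ + (0 : ℂ) * E22 τ)) τ) →
        ‖E11 t‖ ≤ C * (g t / g s) * Real.exp ((‖ξ‖ ^ 2 / 2) * ∫ τ in s..t, g τ) ∧
        ‖E12 t‖ ≤ C * (g t / g s) * Real.exp ((‖ξ‖ ^ 2 / 2) * ∫ τ in s..t, g τ) ∧
        ‖E21 t‖ ≤ C * (g t / g s) * Real.exp ((‖ξ‖ ^ 2 / 2) * ∫ τ in s..t, g τ) ∧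
        ‖E22 t‖ ≤ C * (g t / g s) * Real.exp ((‖ξ‖ ^ 2 / 2) * ∫ τ in s..t, g τ) := by
  refine ⟨1, one_pos, 6 * Real.exp (∫ τ in Ici (0:ℝ), 1 / g τ), by positivity, ?_⟩
  intro ξ hξ s t hs hst _ E11 E12 E21 E22 h11 h12 h21 h22 hE
  have hm : 0 < ‖ξ‖ ^ 2 / 2 := by
    have := norm_pos_iff.2 hξ
    positivity
  have hgc : ContinuousOn g (Ici 0) := fun τ hτ => (hg_deriv τ hτ).continuousWithinAt
  -- continuous extension of `g` to the whole line
  have hhc : Continuous (fun τ : ℝ => g (max τ 0)) :=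
    hgc.comp_continuous (by fun_prop) fun τ => mem_Ici.2 (le_max_right _ _)
  have hh0 : ∀ τ : ℝ, 0 < g (max τ 0) := fun τ => (hA1 _ (mem_Ici.2 (le_max_right _ _))).1
  have hkc : Continuous (fun τ : ℝ => 1 / g (max τ 0)) :=
    continuous_const.div hhc fun τ => (hh0 τ).ne'
  have hheq : ∀ τ, 0 ≤ τ → g (max τ 0) = g τ := fun τ hτ => by rw [max_eq_left hτ]
  have hAder : ∀ τ, HasDerivAt (fun u => ∫ r in s..u, 1 / g (max r 0)) (1 / g (max τ 0)) τ :=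
    fun τ => intervalIntegral.integral_hasDerivAt_right (hkc.intervalIntegrable _ _)
      (hkc.stronglyMeasurableAtFilter _ _) hkc.continuousAt
  have hΓder : ∀ τ, HasDerivAt (fun u => ‖ξ‖ ^ 2 / 2 * ∫ r in s..u, g (max r 0))
      (‖ξ‖ ^ 2 / 2 * g (max τ 0)) τ :=
    fun τ => (intervalIntegral.integral_hasDerivAt_right (hhc.intervalIntegrable _ _)
      (hhc.stronglyMeasurableAtFilter _ _) hhc.continuousAt).const_mul _
  have hsub : Icc s t ⊆ Ici (0:ℝ) := fun τ hτ => hs.trans hτ.1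
  have hAK : (∫ r in s..t, 1 / g (max r 0)) ≤ ∫ τ in Ici (0:ℝ), 1 / g τ := by
    rw [intervalIntegral.integral_of_le hst]
    have e1 : ∫ r in Ioc s t, 1 / g (max r 0) = ∫ r in Ioc s t, 1 / g r :=
      setIntegral_congr_fun measurableSet_Ioc fun r hr => by
        simp only [hheq r (hs.trans hr.1.le)]
    rw [e1]
    refine setIntegral_mono_set hA2 ?_ ?_
    · refine (ae_restrict_iff' measurableSet_Ici).2 (Filter.Eventually.of_forall fun r hr => ?_)
      have := (hA1 r hr).1
      simp only [Pi.zero_apply]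
      positivity
    · exact (Ioc_subset_Icc_self.trans hsub).eventuallyLE
  have hΓt : (∫ r in s..t, g (max r 0)) = ∫ τ in s..t, g τ := by
    refine intervalIntegral.integral_congr fun r hr => ?_
    rw [uIcc_of_le hst] at hr
    exact hheq r (hsub hr)
  have col := aux_column g g' (fun u => ∫ r in s..u, 1 / g (max r 0))
    (fun u => ‖ξ‖ ^ 2 / 2 * ∫ r in s..u, g (max r 0)) (‖ξ‖ ^ 2 / 2) s t
    (∫ τ in Ici (0:ℝ), 1 / g τ) hm hst (hgc.mono hsub)
    (fun τ _ => (hAder τ).continuousAt.continuousWithinAt)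
    (fun τ _ => (hΓder τ).continuousAt.continuousWithinAt)
    (fun τ hτ => (hA1 τ (hsub hτ)).1)
    (fun τ hτ => (hA1 τ (hsub (Ioo_subset_Icc_self hτ))).2.le)
    (fun τ hτ => intervalIntegral.integral_nonneg hτ.1 fun r _ => by
      have := hh0 r
      positivity)
    (by simp) hAK (by simp)
    (fun τ hτ => (hg_deriv τ (hsub (Ioo_subset_Icc_self hτ))).hasDerivAt
      (Ici_mem_nhds (hs.trans_lt hτ.1)))
    (fun τ hτ => by
      have := hAder τ
      rwa [hheq τ (hsub (Ioo_subset_Icc_self hτ))] at this)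
    (fun τ hτ => by
      have := hΓder τ
      rwa [hheq τ (hsub (Ioo_subset_Icc_self hτ))] at this)
  simp only [hΓt] at col
  have hre : ∀ τ, g τ * ‖ξ‖ ^ 2 / 2 = ‖ξ‖ ^ 2 / 2 * g τ := fun τ => by ring
  simp only [hre, zero_mul, add_zero] at hE
  obtain ⟨c1, c2⟩ := col E11 E21 (fun τ hτ => (hE τ hτ.1).1) (fun τ hτ => (hE τ hτ.1).2.1)
    (by simp [h11]) (by simp [h11, h21])
  obtain ⟨c3, c4⟩ := col E12 E22 (fun τ hτ => (hE τ hτ.1).2.2.1)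
    (fun τ hτ => (hE τ hτ.1).2.2.2) (by simp [h12]) (by simp [h12, h22])
  exact ⟨c1, c3, c2, c4⟩
end

section
/- Assume g ∈ C²([0,∞)) satisfies (A1) g(t)>0 and g'(t)>0, (A2) 1/g ∈ L¹(0,∞), and (A3) |d_t^k g(t)| ≤ C_k g(t)(g(t)/G(t))^k for k=1,2, with G(t)=½∫₀ᵗ g(τ)dτ. Then there exist N > 0 and C > 0 such that for every ξ ≠ 0, every C² solution û(·,ξ) of the Fourier-transformed equation, all s ≤ t with G(s)|ξ|² ≥ N, and all real exponents: for s' ≥ 2, |ξ|^{s'} |û(t,ξ)| ≤ C ( |ξ|^{s'} |û(s,ξ)| + (1/g(s)) |ξ|^{s'−2} |û_t(s,ξ)| ), and for r ≥ 0, |ξ|^{r} |û_t(t,ξ)| ≤ C ( g(t) |ξ|^{r+2} |û(s,ξ)| + (g(t)/g(s)) |ξ|^{r} |û_t(s,ξ)| ). -/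
open Set MeasureTheory

/-- Pointwise differential inequality for the regularised energy. -/
lemma energy_alg (k g g' ε a b c d p q : ℝ) (hk : 0 < k) (hg : 0 < g) (hg' : 0 < g')
    (hε : 0 < ε) (ha : 0 ≤ a) (hb : 0 ≤ b) (hp0 : 0 < p) (hq0 : 0 < q)
    (hp : p ^ 2 = ε ^ 2 + a ^ 2) (hq : q ^ 2 = ε ^ 2 + b ^ 2)
    (hc : c ≤ a * b) (hd : d ≤ k * (a * b) - g * k * b ^ 2) :
    c / p + (d / q * (k * g) - q * (k * g')) / (k * g) ^ 2 ≤ (p + q / (k * g)) * (1 / g) + ε := by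
  have hap : a ≤ p := by nlinarith
  have hbq : b ≤ q := by nlinarith
  have hqb : q ≤ b + ε := by nlinarith
  have h1 : c / p ≤ b := by
    rw [div_le_iff₀ hp0]; nlinarith
  have h2 : d / q ≤ k * a - g * k * (b - ε) := by
    rw [div_le_iff₀ hq0]
    have e1 : b * a ≤ q * a := mul_le_mul_of_nonneg_right hbq ha
    have e2 : (b - ε) * q ≤ b ^ 2 := by nlinarith
    have e3 := mul_le_mul_of_nonneg_left e1 hk.le
    have e4 := mul_le_mul_of_nonneg_left e2 (mul_pos hg hk).le
    nlinarith
  have hkg : 0 < k * g := mul_pos hk hg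
  have h3 : (d / q * (k * g) - q * (k * g')) / (k * g) ^ 2 ≤ a / g - (b - ε) := by
    have : a / g - (b - ε) = (k * a - g * k * (b - ε)) * (k * g) / (k * g) ^ 2 := by
      field_simp
    rw [this]
    apply div_le_div_of_nonneg_right _ (by positivity)
    have := mul_le_mul_of_nonneg_right h2 hkg.le
    have h5 : 0 < q * (k * g') := by positivity
    linarith
  have h4 : a / g ≤ (p + q / (k * g)) * (1 / g) := by
    rw [div_eq_mul_one_div]
    apply mul_le_mul_of_nonneg_right _ (by positivity)
    have : 0 < q / (k * g) := by positivity
    linarith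
  linarith

lemma hasDerivAt_reg (ε : ℝ) (hε : 0 < ε) (u : ℝ → ℂ) (v : ℂ) (x : ℝ) (h : HasDerivAt u v x) :
    HasDerivAt (fun y => √(ε ^ 2 + ‖u y‖ ^ 2)) (inner ℝ (u x) v / √(ε ^ 2 + ‖u x‖ ^ 2)) x := by
  have h1 := (h.norm_sq.const_add (ε ^ 2)).sqrt (by positivity)
  convert h1 using 1
  rw [mul_div_mul_left _ _ two_ne_zero]

lemma energy_reg (k : ℝ) (hk : 0 < k) (g g' : ℝ → ℝ)
    (hg_deriv : ∀ t ∈ Ici (0:ℝ), HasDerivWithinAt g (g' t) (Ici 0) t)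
    (hA1 : ∀ t ∈ Ici (0:ℝ), 0 < g t ∧ 0 < g' t)
    (u u' u'' : ℝ → ℂ)
    (hu : ∀ t ∈ Ici (0:ℝ), HasDerivWithinAt u (u' t) (Ici 0) t)
    (hu' : ∀ t ∈ Ici (0:ℝ), HasDerivWithinAt u' (u'' t) (Ici 0) t)
    (heq : ∀ t ∈ Ici (0:ℝ), u'' t + (k : ℂ) * u t + (g t : ℂ) * (k : ℂ) * u' t = 0)
    (s t : ℝ) (hs : 0 ≤ s) (hst : s ≤ t) (ε : ℝ) (hε : 0 < ε) :
    (√(ε ^ 2 + ‖u t‖ ^ 2) + √(ε ^ 2 + ‖u' t‖ ^ 2) / (k * g t)) *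
        Real.exp (-∫ x in s..t, 1 / g x) ≤
      √(ε ^ 2 + ‖u s‖ ^ 2) + √(ε ^ 2 + ‖u' s‖ ^ 2) / (k * g s) + ε * (t - s) := by
  have hsub : Icc s t ⊆ Ici 0 := fun x hx => hs.trans hx.1
  have hgc : ContinuousOn g (Ici 0) := fun x hx => (hg_deriv x hx).continuousWithinAt
  have huc : ContinuousOn u (Icc s t) := fun x hx =>
    ((hu x (hsub hx)).continuousWithinAt).mono hsub
  have huc' : ContinuousOn u' (Icc s t) := fun x hx =>
    ((hu' x (hsub hx)).continuousWithinAt).mono hsub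
  have hic : ContinuousOn (fun x => 1 / g x) (Ici 0) :=
    continuousOn_const.div hgc (fun x hx => (hA1 x hx).1.ne')
  have hint : ∀ y ∈ Icc s t, IntervalIntegrable (fun x => 1 / g x) volume s y := by
    intro y hy
    apply ContinuousOn.intervalIntegrable
    apply hic.mono
    rw [uIcc_of_le hy.1]
    exact fun x hx => hs.trans hx.1
  have hHc : ContinuousOn (fun y => ∫ x in s..y, 1 / g x) (Icc s t) := by
    have := intervalIntegral.continuousOn_primitive_interval (μ := volume)
      (f := fun x => 1 / g x) (a := s) (b := t) (by
        rw [uIcc_of_le hst]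
        exact (hic.mono hsub).integrableOn_Icc)
    rwa [uIcc_of_le hst] at this
  have hnk : ∀ x ∈ Icc s t, k * g x ≠ 0 := fun x hx =>
    (mul_pos hk (hA1 x (hsub hx)).1).ne'
  have hgc' := hgc.mono hsub
  let F : ℝ → ℝ := fun y => (√(ε ^ 2 + ‖u y‖ ^ 2) + √(ε ^ 2 + ‖u' y‖ ^ 2) / (k * g y)) *
        Real.exp (-∫ x in s..y, 1 / g x) - ε * (y - s)
  have hF : AntitoneOn F (Icc s t) := by
    have hder : ∀ x ∈ Ioo s t, ∃ D ≤ 0, HasDerivAt F D x := by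
      intro x hx
      have hx0 : 0 < x := hs.trans_lt hx.1
      have hn : Ici (0:ℝ) ∈ nhds x := Ici_mem_nhds hx0
      have hxm : x ∈ Icc s t := Ioo_subset_Icc_self hx
      have d1 := hasDerivAt_reg ε hε u _ x ((hu x hx0.le).hasDerivAt hn)
      have d2 := hasDerivAt_reg ε hε u' _ x ((hu' x hx0.le).hasDerivAt hn)
      have d3 := ((hg_deriv x hx0.le).hasDerivAt hn).const_mul k
      have d4 : HasDerivAt (fun y => ∫ x in s..y, 1 / g x) (1 / g x) x := by
        apply intervalIntegral.integral_hasDerivAt_right (hint x hxm)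
        · exact (hic.mono Ioi_subset_Ici_self).stronglyMeasurableAtFilter isOpen_Ioi x hx0
        · exact hic.continuousAt hn
      have d5 := ((d1.add (d2.div d3 (hnk x hxm))).mul d4.neg.exp).sub
        (((hasDerivAt_id x).sub_const s).const_mul ε)
      refine ⟨_, ?_, d5⟩
      obtain ⟨hgx, hgx'⟩ := hA1 x hx0.le
      have hd : inner ℝ (u' x) (u'' x) ≤
          k * (‖u x‖ * ‖u' x‖) - g x * k * ‖u' x‖ ^ 2 := by
        have e : u'' x = (-k) • u x + (-(g x * k)) • u' x := by
          have := heq x hx0.le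
          simp only [Complex.real_smul]
          push_cast
          linear_combination this
        rw [e, inner_add_right, real_inner_smul_right, real_inner_smul_right,
          real_inner_self_eq_norm_sq]
        have h1 := neg_le_of_abs_le (abs_real_inner_le_norm (u' x) (u x))
        nlinarith
      have key := energy_alg k (g x) (g' x) ε ‖u x‖ ‖u' x‖ (inner ℝ (u x) (u' x))
        (inner ℝ (u' x) (u'' x)) (√(ε ^ 2 + ‖u x‖ ^ 2)) (√(ε ^ 2 + ‖u' x‖ ^ 2)) hk hgx hgx' hε
        (norm_nonneg _) (norm_nonneg _) (by positivity) (by positivity)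
        (Real.sq_sqrt (by positivity)) (Real.sq_sqrt (by positivity))
        (real_inner_le_norm _ _) hd
      have hH0 : 0 ≤ ∫ y in s..x, 1 / g y := by
        apply intervalIntegral.integral_nonneg hx.1.le
        intro y hy
        exact (one_div_pos.2 (hA1 y (hs.trans hy.1)).1).le
      have hexp : Real.exp (-∫ y in s..x, 1 / g y) ≤ 1 := Real.exp_le_one_iff.2 (by linarith)
      have hexp0 := Real.exp_pos (-∫ y in s..x, 1 / g y)
      have k2 := mul_le_mul_of_nonneg_right key hexp0.le
      simp only [Pi.add_apply, Pi.div_apply, Pi.neg_apply]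
      nlinarith
    apply antitoneOn_of_deriv_nonpos (convex_Icc s t)
    · have c1 : ContinuousOn (fun y => √(ε ^ 2 + ‖u y‖ ^ 2)) (Icc s t) := by fun_prop
      have c2 : ContinuousOn (fun y => √(ε ^ 2 + ‖u' y‖ ^ 2)) (Icc s t) := by fun_prop
      have c3 : ContinuousOn (fun y => k * g y) (Icc s t) := by fun_prop
      exact ((c1.add (c2.div c3 hnk)).mul hHc.neg.rexp).sub (by fun_prop)
    · intro x hx
      rw [interior_Icc] at hx
      obtain ⟨D, _, hD⟩ := hder x hx
      exact hD.differentiableAt.differentiableWithinAt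
    · intro x hx
      rw [interior_Icc] at hx
      obtain ⟨D, h0, hD⟩ := hder x hx
      rw [hD.deriv]; exact h0
  have := hF (left_mem_Icc.2 hst) (right_mem_Icc.2 hst) hst
  simp only [F, intervalIntegral.integral_same, neg_zero, Real.exp_zero, sub_self, mul_zero,
    mul_one, sub_zero] at this
  linarith

lemma energy_bound (k : ℝ) (hk : 0 < k) (g g' : ℝ → ℝ)
    (hg_deriv : ∀ t ∈ Ici (0:ℝ), HasDerivWithinAt g (g' t) (Ici 0) t)
    (hA1 : ∀ t ∈ Ici (0:ℝ), 0 < g t ∧ 0 < g' t)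
    (hA2 : IntegrableOn (fun t => 1 / g t) (Ici 0))
    (u u' u'' : ℝ → ℂ)
    (hu : ∀ t ∈ Ici (0:ℝ), HasDerivWithinAt u (u' t) (Ici 0) t)
    (hu' : ∀ t ∈ Ici (0:ℝ), HasDerivWithinAt u' (u'' t) (Ici 0) t)
    (heq : ∀ t ∈ Ici (0:ℝ), u'' t + (k : ℂ) * u t + (g t : ℂ) * (k : ℂ) * u' t = 0)
    (s t : ℝ) (hs : 0 ≤ s) (hst : s ≤ t) :
    ‖u t‖ + ‖u' t‖ / (k * g t) ≤
      Real.exp (∫ x in Ici (0:ℝ), 1 / g x) * (‖u s‖ + ‖u' s‖ / (k * g s)) := by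
  have hgs := (hA1 s hs).1
  have hgt := (hA1 t (hs.trans hst)).1
  have hH : ∫ x in s..t, 1 / g x ≤ ∫ x in Ici (0:ℝ), 1 / g x := by
    rw [intervalIntegral.integral_of_le hst]
    apply setIntegral_mono_set hA2
    · refine (ae_restrict_iff' measurableSet_Ici).2 (ae_of_all _ fun x hx => ?_)
      exact (one_div_pos.2 (hA1 x hx).1).le
    · exact HasSubset.Subset.eventuallyLE (fun x hx => hs.trans hx.1.le)
  have h0 : (‖u t‖ + ‖u' t‖ / (k * g t)) * Real.exp (-∫ x in s..t, 1 / g x) ≤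
      ‖u s‖ + ‖u' s‖ / (k * g s) := by
    have hlim : Filter.Tendsto (fun ε : ℝ => √(ε ^ 2 + ‖u s‖ ^ 2) +
        √(ε ^ 2 + ‖u' s‖ ^ 2) / (k * g s) + ε * (t - s)) (nhdsWithin 0 (Ioi 0))
        (nhds (‖u s‖ + ‖u' s‖ / (k * g s))) := by
      have hc : Continuous (fun ε : ℝ => √(ε ^ 2 + ‖u s‖ ^ 2) +
        √(ε ^ 2 + ‖u' s‖ ^ 2) / (k * g s) + ε * (t - s)) := by fun_prop
      have := (hc.tendsto 0).mono_left (nhdsWithin_le_nhds (s := Ioi (0:ℝ)))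
      simpa [Real.sqrt_sq] using this
    refine ge_of_tendsto hlim ?_
    filter_upwards [self_mem_nhdsWithin] with ε hε
    refine le_trans ?_ (energy_reg k hk g g' hg_deriv hA1 u u' u'' hu hu' heq s t hs hst ε hε)
    have hkg : 0 < k * g t := mul_pos hk hgt
    gcongr
    · exact Real.le_sqrt_of_sq_le (by nlinarith [sq_nonneg ε])
    · exact Real.le_sqrt_of_sq_le (by nlinarith [sq_nonneg ε])
  have h1 : 0 ≤ ‖u s‖ + ‖u' s‖ / (k * g s) := by positivity
  rw [Real.exp_neg, ← div_eq_mul_inv, div_le_iff₀ (Real.exp_pos _)] at h0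
  rw [mul_comm (Real.exp _)]
  exact h0.trans (mul_le_mul_of_nonneg_left (Real.exp_le_exp.2 hH) h1)

theorem stmt_3
    (n : ℕ)
    (g g' g'' : ℝ → ℝ)
    (hg_deriv : ∀ t ∈ Ici (0:ℝ), HasDerivWithinAt g (g' t) (Ici 0) t)
    (hg_deriv' : ∀ t ∈ Ici (0:ℝ), HasDerivWithinAt g' (g'' t) (Ici 0) t)
    (hg_cont : ContinuousOn g'' (Ici 0))
    (hA1 : ∀ t ∈ Ici (0:ℝ), 0 < g t ∧ 0 < g' t)
    (hA2 : IntegrableOn (fun t => 1 / g t) (Ici 0))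
    (hA3 : ∃ C₁ > (0:ℝ), ∃ C₂ > (0:ℝ), ∀ t ∈ Ici (0:ℝ),
      |g' t| * ((1/2) * ∫ τ in (0:ℝ)..t, g τ) ≤ C₁ * g t * g t ∧
      |g'' t| * ((1/2) * ∫ τ in (0:ℝ)..t, g τ) ^ 2 ≤ C₂ * g t * g t ^ 2)
    :
    ∃ N > (0:ℝ), ∃ C > (0:ℝ),
      ∀ (ξ : EuclideanSpace ℝ (Fin n)), ξ ≠ 0 →
      ∀ (u u' u'' : ℝ → ℂ),
      (∀ t ∈ Ici (0:ℝ), HasDerivWithinAt u (u' t) (Ici 0) t) →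
      (∀ t ∈ Ici (0:ℝ), HasDerivWithinAt u' (u'' t) (Ici 0) t) →
      ContinuousOn u'' (Ici 0) →
      (∀ t ∈ Ici (0:ℝ),
        u'' t + (‖ξ‖ : ℂ) ^ 2 * u t + (g t : ℂ) * (‖ξ‖ : ℂ) ^ 2 * u' t = 0) →
      ∀ s t : ℝ, 0 ≤ s → s ≤ t →
        N ≤ ((1/2) * ∫ τ in (0:ℝ)..s, g τ) * ‖ξ‖ ^ 2 →
        (∀ s' : ℝ, 2 ≤ s' →
          ‖ξ‖ ^ s' * ‖u t‖ ≤
            C * (‖ξ‖ ^ s' * ‖u s‖ + (1 / g s) * ‖ξ‖ ^ (s' - 2) * ‖u' s‖)) ∧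
        (∀ r : ℝ, 0 ≤ r →
          ‖ξ‖ ^ r * ‖u' t‖ ≤
            C * (g t * ‖ξ‖ ^ (r + 2) * ‖u s‖ + (g t / g s) * ‖ξ‖ ^ r * ‖u' s‖)) := by
  refine ⟨1, one_pos, Real.exp (∫ x in Ici (0:ℝ), 1 / g x), Real.exp_pos _, ?_⟩
  intro ξ hξ u u' u'' hu hu' _ heq s t hs hst _
  have hx : 0 < ‖ξ‖ := norm_pos_iff.2 hξ
  have hgs := (hA1 s hs).1
  have hgt := (hA1 t (hs.trans hst)).1
  have main := energy_bound (‖ξ‖ ^ 2) (by positivity) g g' hg_deriv hA1 hA2 u u' u'' hu hu'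
    (fun t ht => by push_cast; exact heq t ht) s t hs hst
  set C := Real.exp (∫ x in Ici (0:ℝ), 1 / g x)
  constructor
  · intro s' _
    have h1 : ‖u t‖ ≤ C * (‖u s‖ + ‖u' s‖ / (‖ξ‖ ^ 2 * g s)) := by
      have : 0 ≤ ‖u' t‖ / (‖ξ‖ ^ 2 * g t) := by positivity
      linarith
    have h2 := mul_le_mul_of_nonneg_left h1 (Real.rpow_nonneg hx.le s')
    refine h2.trans (le_of_eq ?_)
    rw [Real.rpow_sub hx, Real.rpow_two]
    field_simp
  · intro r _
    have h1 : ‖u' t‖ / (‖ξ‖ ^ 2 * g t) ≤ C * (‖u s‖ + ‖u' s‖ / (‖ξ‖ ^ 2 * g s)) := by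
      have : 0 ≤ ‖u t‖ := norm_nonneg _
      linarith
    rw [div_le_iff₀ (by positivity)] at h1
    have h2 := mul_le_mul_of_nonneg_left h1 (Real.rpow_nonneg hx.le r)
    refine h2.trans (le_of_eq ?_)
    rw [Real.rpow_add hx, Real.rpow_two]
    field_simp
end
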